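/- arXiv:1207.5780 — 2 statements merged into one kernel-verified Lean document; each statement's English description precedes it below -/
import Mathlib

section
/- Every simple weight A-module is isomorphic, as an A-module, to L(p) = N_p/N''_p for some p : I → k. -/
set_option synthInstance.maxHeartbeats 1000000
set_option maxHeartbeats 4000000

noncomputable section

open MvPolynomial

universe u v

variable (k : Type u) (I : Type v) [Field k]

/-- Multiplication by the variable `x i` on the polynomial algebra `B`. -/
def Xop (i : I) : Module.End k (MvPolynomial I k) :=
  LinearMap.mulLeft k (MvPolynomial.X i)

/-- The partial derivative `∂/∂x i` on the polynomial algebra `B`. -/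
def Yop (i : I) : Module.End k (MvPolynomial I k) :=
  (MvPolynomial.pderiv i).toLinearMap

/-- The infinite Weyl algebra `A`: the subalgebra of `Module.End k B` generated by
all `X i` and `Y i`. -/
def Weyl : Subalgebra k (Module.End k (MvPolynomial I k)) :=
  Algebra.adjoin k (Set.range (Xop k I) ∪ Set.range (Yop k I))

instance : Ring (Weyl k I) := inferInstance
instance : Algebra k (Weyl k I) := inferInstance

/-- `X i` as an element of the Weyl algebra. -/
def XA (i : I) : Weyl k I :=
  ⟨Xop k I i, Algebra.subset_adjoin (Set.mem_union_left _ ⟨i, rfl⟩)⟩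

/-- `Y i` as an element of the Weyl algebra. -/
def YA (i : I) : Weyl k I :=
  ⟨Yop k I i, Algebra.subset_adjoin (Set.mem_union_right _ ⟨i, rfl⟩)⟩

/-- `t i = X i * Y i` as an element of the Weyl algebra. -/
def tA (i : I) : Weyl k I := XA k I i * YA k I i

/-- The shift operator `S i : e_v ↦ e_{v + δ i}` on the free module `(I →₀ ℤ) →₀ k`. -/
def Sop (i : I) : Module.End k ((I →₀ ℤ) →₀ k) :=
  Finsupp.lmapDomain k k (fun v => v + Finsupp.single i 1)

/-- The twisted derivative operator `D i : e_v ↦ (p i + v i) • e_{v - δ i}`. -/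
def Dop (p : I → k) (i : I) : Module.End k ((I →₀ ℤ) →₀ k) :=
  Finsupp.lsum k fun v =>
    LinearMap.toSpanSingleton k ((I →₀ ℤ) →₀ k)
      ((p i + ((v i : ℤ) : k)) • Finsupp.single (v - Finsupp.single i 1) (1 : k))

/-- The space `V = (I →₀ ℤ) →₀ k` regarded as a module over the Weyl algebra through a
homomorphism `ρ : A →ₐ[k] End_k V`; this is the module `B(p)` when `ρ = ρ_p`. -/
def BMod (ρ : Weyl k I →ₐ[k] Module.End k ((I →₀ ℤ) →₀ k)) : Type (max u v) :=
  (I →₀ ℤ) →₀ k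

variable {k I} in
instance (ρ : Weyl k I →ₐ[k] Module.End k ((I →₀ ℤ) →₀ k)) : AddCommGroup (BMod k I ρ) :=
  inferInstanceAs (AddCommGroup ((I →₀ ℤ) →₀ k))

variable {k I} in
instance (ρ : Weyl k I →ₐ[k] Module.End k ((I →₀ ℤ) →₀ k)) : Module k (BMod k I ρ) :=
  inferInstanceAs (Module k ((I →₀ ℤ) →₀ k))

variable {k I} in
instance (ρ : Weyl k I →ₐ[k] Module.End k ((I →₀ ℤ) →₀ k)) :
    Module (Weyl k I) (BMod k I ρ) where
  smul a x := ρ a x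
  one_smul x := by show ρ 1 x = x; rw [map_one]; rfl
  mul_smul a b x := by show ρ (a * b) x = ρ a (ρ b x); rw [map_mul]; rfl
  smul_zero a := map_zero (ρ a)
  smul_add a x y := map_add (ρ a) x y
  add_smul a b x := by show ρ (a + b) x = ρ a x + ρ b x; rw [map_add]; rfl
  zero_smul x := by show ρ 0 x = 0; rw [map_zero]; rfl

variable {k I} in
instance (ρ : Weyl k I →ₐ[k] Module.End k ((I →₀ ℤ) →₀ k)) :
    IsScalarTower k (Weyl k I) (BMod k I ρ) :=
  ⟨fun c a x => by
    show ρ (c • a) x = c • (ρ a x)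
    rw [map_smul]
    rfl⟩

/-- The basis vector `e_v` of `B(p)`. -/
def eV (ρ : Weyl k I →ₐ[k] Module.End k ((I →₀ ℤ) →₀ k)) (v : I →₀ ℤ) : BMod k I ρ :=
  Finsupp.single v 1

/-- `c` is a nonnegative integer. -/
def IsNonnegInt (c : k) : Prop := ∃ n : ℕ, c = n

/-- `c` is a negative integer. -/
def IsNegInt (c : k) : Prop := ∃ m : ℤ, m < 0 ∧ c = m

/-- The index set `S` of the submodule `N ⊆ B(p)`. -/
def Sset (p : I → k) : Set (I →₀ ℤ) :=
  {v | ∀ i, IsNonnegInt k (p i) → IsNonnegInt k (p i + ((v i : ℤ) : k))}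

/-- The index set `S''` of the submodule `N'' ⊆ N`. -/
def Sset'' (p : I → k) : Set (I →₀ ℤ) :=
  {v | v ∈ Sset k I p ∧ ∃ i, IsNegInt k (p i) ∧ IsNonnegInt k (p i + ((v i : ℤ) : k))}

/-- The `k`-span `N` of the `e_v`, `v ∈ S`. -/
def Nspan (p : I → k) (ρ : Weyl k I →ₐ[k] Module.End k ((I →₀ ℤ) →₀ k)) :
    Submodule k (BMod k I ρ) :=
  Submodule.span k {x | ∃ v ∈ Sset k I p, x = eV k I ρ v}

/-- The `k`-span `N''` of the `e_v`, `v ∈ S''`. -/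
def Nspan'' (p : I → k) (ρ : Weyl k I →ₐ[k] Module.End k ((I →₀ ℤ) →₀ k)) :
    Submodule k (BMod k I ρ) :=
  Submodule.span k {x | ∃ v ∈ Sset'' k I p, x = eV k I ρ v}

/-- The weight space of weight `p` in a module over the Weyl algebra:
all `x` with `t i • x = p i • x` for every `i`. -/
def wtSp (M : Type*) [AddCommGroup M] [Module k M] [Module (Weyl k I) M]
    [IsScalarTower k (Weyl k I) M] (p : I → k) : Submodule k M where
  carrier := {x | ∀ i, tA k I i • x = p i • x}
  add_mem' := by
    intro a b ha hb i
    rw [smul_add, ha i, hb i, ← smul_add]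
  zero_mem' := by intro i; rw [smul_zero, smul_zero]
  smul_mem' := by
    intro c x hx i
    have h : tA k I i • (c • x) = c • (tA k I i • x) := by
      rw [← algebraMap_smul (Weyl k I) c x, ← algebraMap_smul (Weyl k I) c (tA k I i • x),
        smul_smul, smul_smul, Algebra.commutes]
    rw [h, hx i, smul_smul, smul_smul, mul_comm]

universe w

section Existence

variable {k I}

/-- Evaluations of two lifts from the free algebra are intertwined by a linear map as soon as
the images of the generators are. -/
theorem FreeAlgebra.lift_apply_intertwine {G V W : Type*} [AddCommGroup V] [Module k V]
    [AddCommGroup W] [Module k W] (s : G → Module.End k V) (t : G → Module.End k W)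
    (φ : V →ₗ[k] W) (h : ∀ g x, φ (s g x) = t g (φ x)) (f : FreeAlgebra k G) (x : V) :
    φ (FreeAlgebra.lift k s f x) = FreeAlgebra.lift k t f (φ x) := by
  induction f generalizing x with
  | grade0 r => simp [Module.algebraMap_end_apply]
  | grade1 g => simp [h]
  | mul a b ha hb => simp [ha, hb]
  | add a b ha hb => simp [ha, hb]

@[simp]
theorem Sop_single (i : I) (v : I →₀ ℤ) (c : k) :
    Sop k I i (Finsupp.single v c) = Finsupp.single (v + Finsupp.single i 1) c := by
  simp [Sop]

@[simp]
theorem Dop_single (p : I → k) (i : I) (v : I →₀ ℤ) (c : k) :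
    Dop k I p i (Finsupp.single v c) =
      Finsupp.single (v - Finsupp.single i 1) (c * (p i + (v i : k))) := by
  rw [Dop, Finsupp.lsum_single, LinearMap.toSpanSingleton_apply, smul_smul,
    Finsupp.smul_single, smul_eq_mul, mul_one]

/-- The generators `S i`, `D i` of the action on `B(p)`. -/
def shiftOps (p : I → k) : I ⊕ I → Module.End k ((I →₀ ℤ) →₀ k) :=
  Sum.elim (Sop k I) (Dop k I p)

/-- The generators of the Weyl algebra. -/
def weylGens : I ⊕ I → Weyl k I := Sum.elim (XA k I) (YA k I)

/-- The generators of the action on the generic module, in which the weights are the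
indeterminates `X i`. -/
def genericOps : I ⊕ I → Module.End k ((I →₀ ℤ) →₀ MvPolynomial I k) :=
  Sum.elim
    (fun i => Finsupp.lsum k fun u => Finsupp.lsingle (u + Finsupp.single i 1))
    (fun i => Finsupp.lsum k fun u => Finsupp.lsingle (u - Finsupp.single i 1) ∘ₗ
      LinearMap.mulLeft k (X i + C (u i : k)))

/-- Specialization of the generic module at the weight `p + v`. -/
def specialize (p : I → k) (v : I →₀ ℤ) :
    ((I →₀ ℤ) →₀ MvPolynomial I k) →ₗ[k] ((I →₀ ℤ) →₀ k) :=
  Finsupp.lsum k fun u => Finsupp.lsingle (u + v) ∘ₗ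
    (aeval fun i => p i + (v i : k)).toLinearMap

theorem specialize_single (p : I → k) (v u : I →₀ ℤ) (c : MvPolynomial I k) :
    specialize p v (Finsupp.single u c) =
      Finsupp.single (u + v) (aeval (fun i => p i + (v i : k)) c) := by
  simp [specialize]

theorem specialize_genericOps (p : I → k) (v : I →₀ ℤ) (g : I ⊕ I)
    (x : (I →₀ ℤ) →₀ MvPolynomial I k) :
    specialize p v (genericOps g x) = shiftOps p g (specialize p v x) := by
  induction x using Finsupp.induction_linear with
  | zero => simp
  | add x y hx hy => simp only [map_add, hx, hy]
  | single u c =>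
    rcases g with i | i
    · simp [genericOps, shiftOps, specialize_single, add_right_comm]
    · simp only [genericOps, shiftOps, Sum.elim_inr, Finsupp.lsum_single, LinearMap.comp_apply,
        LinearMap.mulLeft_apply, Finsupp.lsingle_apply, specialize_single, Dop_single, map_mul,
        map_add, aeval_X, aeval_C, sub_add_eq_add_sub, Finsupp.add_apply, Int.cast_add]
      congr 1
      simp only [Algebra.algebraMap_self, RingHom.id_apply]
      ring

/-- The embedding `x ^ n ↦ e_n` of the polynomial algebra into `B(0)`. -/
def polyEmb : MvPolynomial I k →ₗ[k] ((I →₀ ℤ) →₀ k) :=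
  (basisMonomials I k).constr k fun n => Finsupp.single (n.mapRange (Nat.cast : ℕ → ℤ) rfl) 1

theorem polyEmb_monomial (n : I →₀ ℕ) (c : k) :
    polyEmb (monomial n c) = Finsupp.single (n.mapRange (Nat.cast : ℕ → ℤ) rfl) c := by
  have h : monomial n c = c • basisMonomials I k n := by simp [smul_monomial]
  rw [h, map_smul, polyEmb, Module.Basis.constr_basis]
  simp

theorem polyEmb_weylGens (g : I ⊕ I) (f : MvPolynomial I k) :
    polyEmb ((weylGens g : Weyl k I).1 f) = shiftOps 0 g (polyEmb f) := by
  induction f using MvPolynomial.induction_on' with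
  | add f g hf hg => simp only [map_add, hf, hg]
  | monomial n c =>
    rcases g with i | i
    · have h : X i * monomial n c = monomial (n + Finsupp.single i 1) c := by
        rw [X, monomial_mul, one_mul, add_comm]
      simp only [weylGens, XA, Xop, Sum.elim_inl, LinearMap.mulLeft_apply, h, polyEmb_monomial,
        shiftOps, Sop_single]
      congr 1
      ext j
      by_cases hj : i = j <;> simp [hj]
    · simp only [weylGens, YA, Yop, Sum.elim_inr, Derivation.coeFn_coe, pderiv_monomial,
        polyEmb_monomial, shiftOps, Dop_single]
      rcases Nat.eq_zero_or_pos (n i) with h0 | h0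
      · simp [h0]
      · congr 1
        · ext j
          by_cases hj : i = j
          · subst hj
            simp
            omega
          · simp [hj]
        · simp

theorem lift_weylGens_surjective :
    Function.Surjective (FreeAlgebra.lift k (weylGens : I ⊕ I → Weyl k I)) := by
  rintro ⟨a, ha⟩
  suffices h : ∃ f, (FreeAlgebra.lift k (weylGens : I ⊕ I → Weyl k I) f).1 = a by
    obtain ⟨f, hf⟩ := h
    exact ⟨f, Subtype.ext hf⟩
  induction ha using Algebra.adjoin_induction with
  | mem x hx =>
    rcases hx with ⟨i, rfl⟩ | ⟨i, rfl⟩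
    · exact ⟨FreeAlgebra.ι k (Sum.inl i), by simp [weylGens, XA]⟩
    · exact ⟨FreeAlgebra.ι k (Sum.inr i), by simp [weylGens, YA]⟩
  | algebraMap r => exact ⟨algebraMap k _ r, by rw [AlgHom.commutes]; rfl⟩
  | add x y _ _ hx hy =>
    obtain ⟨f, rfl⟩ := hx
    obtain ⟨g, rfl⟩ := hy
    exact ⟨f + g, by rw [map_add]; rfl⟩
  | mul x y _ _ hx hy =>
    obtain ⟨f, rfl⟩ := hx
    obtain ⟨g, rfl⟩ := hy
    exact ⟨f * g, by rw [map_mul]; rfl⟩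

/-- A polynomial vanishing at all finitely supported tuples of natural numbers is zero. -/
theorem MvPolynomial.eq_zero_of_forall_natCast_finsupp [CharZero k] (c : MvPolynomial I k)
    (h : ∀ n : I →₀ ℕ, aeval (fun i => ((n i : ℕ) : k)) c = 0) : c = 0 := by
  classical
  refine funext_set (fun _ => Set.range (Nat.cast : ℕ → k))
    (fun _ => Set.infinite_range_of_injective Nat.cast_injective) fun x hx => ?_
  choose n hn using fun i => hx i (Set.mem_univ i)
  rw [map_zero, ← h (Finsupp.onFinset c.vars (fun i => if i ∈ c.vars then n i else 0)
    (by intro i hi; by_contra hc; simp [hc] at hi)), ← coe_aeval_eq_eval]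
  refine eval₂Hom_congr' rfl (fun i hi _ => ?_) rfl
  simp [hi, hn]

theorem lift_shiftOps_eq_zero [CharZero k] (p : I → k) (f : FreeAlgebra k (I ⊕ I))
    (hf : FreeAlgebra.lift k (weylGens : I ⊕ I → Weyl k I) f = 0) :
    FreeAlgebra.lift k (shiftOps p) f = 0 := by
  have hB : ∀ x : MvPolynomial I k,
      FreeAlgebra.lift k (fun g => (weylGens g : Weyl k I).1) f x = 0 := by
    intro x
    have : FreeAlgebra.lift k (fun g => (weylGens g : Weyl k I).1) =
        (Weyl k I).val.comp (FreeAlgebra.lift k weylGens) := by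
      ext; simp
    rw [this, AlgHom.comp_apply, hf, map_zero, LinearMap.zero_apply]
  have hW : FreeAlgebra.lift k genericOps f (Finsupp.single 0 (1 : MvPolynomial I k)) = 0 := by
    ext1 u
    refine MvPolynomial.eq_zero_of_forall_natCast_finsupp _ fun n => ?_
    set m : I →₀ ℤ := n.mapRange (Nat.cast : ℕ → ℤ) rfl with hm
    have h1 := FreeAlgebra.lift_apply_intertwine _ _ _ polyEmb_weylGens f (monomial n (1 : k))
    rw [hB, map_zero, polyEmb_monomial] at h1
    have h2 := FreeAlgebra.lift_apply_intertwine _ _ _ (specialize_genericOps (0 : I → k) m) f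
      (Finsupp.single 0 1)
    rw [specialize_single, map_one, zero_add, ← h1] at h2
    have h3 : ∀ w : (I →₀ ℤ) →₀ MvPolynomial I k, specialize (0 : I → k) m w (u + m) =
        aeval (fun i => ((n i : ℕ) : k)) (w u) := by
      intro w
      induction w using Finsupp.induction_linear with
      | zero => simp
      | add x y hx hy => simp only [map_add, Finsupp.add_apply, hx, hy]
      | single v c =>
        rw [specialize_single]
        by_cases hv : v = u
        · subst hv
          simp [hm]
        · simp [hv]
    rw [← h3, h2, Finsupp.zero_apply]
  refine LinearMap.ext fun x => ?_
  induction x using Finsupp.induction_linear with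
  | zero => simp
  | add x y hx hy => simp only [map_add, hx, hy]
  | single v c =>
    have h := FreeAlgebra.lift_apply_intertwine _ _ _ (specialize_genericOps p v) f
      (Finsupp.single 0 1)
    rw [hW, map_zero, specialize_single, map_one, zero_add] at h
    rw [← mul_one c, ← smul_eq_mul, ← Finsupp.smul_single, map_smul, ← h]
    simp

/-- An algebra homomorphism factors through any surjection with smaller kernel. -/
theorem AlgHom.exists_comp_eq_of_forall_eq_zero {R A B C : Type*} [CommRing R] [Ring A] [Ring B] [Ring C]
    [Algebra R A] [Algebra R B] [Algebra R C] (f : A →ₐ[R] B) (g : A →ₐ[R] C)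
    (hf : Function.Surjective f) (h : ∀ a, f a = 0 → g a = 0) :
    ∃ ρ : B →ₐ[R] C, ρ.comp f = g := by
  refine ⟨(Ideal.Quotient.liftₐ (RingHom.ker f) g fun a ha => h a ha).comp
    (Ideal.quotientKerAlgEquivOfSurjective hf).symm.toAlgHom, AlgHom.ext fun a => ?_⟩
  have h1 : (Ideal.quotientKerAlgEquivOfSurjective hf).symm (f a) = Ideal.Quotient.mk _ a := by
    rw [AlgEquiv.symm_apply_eq]; rfl
  change Ideal.Quotient.liftₐ (RingHom.ker f) g (fun a ha => h a ha)
    ((Ideal.quotientKerAlgEquivOfSurjective hf).symm (f a)) = g a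
  rw [h1]
  rfl

/-- The representation `ρ_p` exists. -/
theorem exists_shiftRep [CharZero k] (p : I → k) :
    ∃ ρ : Weyl k I →ₐ[k] Module.End k ((I →₀ ℤ) →₀ k),
      (∀ i, ρ (XA k I i) = Sop k I i) ∧ ∀ i, ρ (YA k I i) = Dop k I p i := by
  obtain ⟨ρ, hρ⟩ := AlgHom.exists_comp_eq_of_forall_eq_zero
    (FreeAlgebra.lift k (weylGens : I ⊕ I → Weyl k I)) (FreeAlgebra.lift k (shiftOps p))
    lift_weylGens_surjective (lift_shiftOps_eq_zero p)
  refine ⟨ρ, fun i => ?_, fun i => ?_⟩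
  · simpa [weylGens, shiftOps] using DFunLike.congr_fun hρ (FreeAlgebra.ι k (Sum.inl i))
  · simpa [weylGens, shiftOps] using DFunLike.congr_fun hρ (FreeAlgebra.ι k (Sum.inr i))

end Existence

section Weights

variable {k I}

theorem pderiv_pderiv_comm (i j : I) (f : MvPolynomial I k) :
    pderiv i (pderiv j f) = pderiv j (pderiv i f) := by
  classical
  have h : ⁅pderiv (R := k) i, pderiv (R := k) j⁆ = 0 := by
    refine derivation_ext fun l => ?_
    rw [Derivation.commutator_apply, pderiv_X, pderiv_X]
    simp only [Pi.single_apply]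
    split_ifs <;> simp
  have h' := DFunLike.congr_fun h f
  rw [Derivation.commutator_apply] at h'
  exact sub_eq_zero.mp h'

theorem XA_mul_comm (i j : I) : XA k I i * XA k I j = XA k I j * XA k I i := by
  have h : Xop k I i * Xop k I j = Xop k I j * Xop k I i := by
    refine LinearMap.ext fun f => ?_
    simp only [Module.End.mul_apply, Xop, LinearMap.mulLeft_apply]
    ring
  exact Subtype.ext h

theorem YA_mul_comm (i j : I) : YA k I i * YA k I j = YA k I j * YA k I i := by
  have h : Yop k I i * Yop k I j = Yop k I j * Yop k I i :=
    LinearMap.ext fun f => pderiv_pderiv_comm i j f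
  exact Subtype.ext h

theorem YA_mul_XA_self (i : I) : YA k I i * XA k I i = XA k I i * YA k I i + 1 := by
  have h : Yop k I i * Xop k I i = Xop k I i * Yop k I i + 1 := by
    refine LinearMap.ext fun f => ?_
    simp only [Module.End.mul_apply, Xop, Yop, LinearMap.mulLeft_apply, LinearMap.add_apply,
      Derivation.coeFn_coe, pderiv_mul, pderiv_X_self, Module.End.one_apply]
    ring
  exact Subtype.ext h

theorem YA_mul_XA_of_ne {i j : I} (hij : i ≠ j) :
    YA k I i * XA k I j = XA k I j * YA k I i := by
  have h : Yop k I i * Xop k I j = Xop k I j * Yop k I i := by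
    refine LinearMap.ext fun f => ?_
    simp only [Module.End.mul_apply, Xop, Yop, LinearMap.mulLeft_apply,
      Derivation.coeFn_coe, pderiv_mul, pderiv_X_of_ne hij.symm]
    ring
  exact Subtype.ext h

theorem Weyl.induction_on {P : Weyl k I → Prop} (a : Weyl k I)
    (algebraMap : ∀ c, P (algebraMap k (Weyl k I) c)) (XA : ∀ i, P (XA k I i))
    (YA : ∀ i, P (YA k I i)) (add : ∀ a b, P a → P b → P (a + b))
    (mul : ∀ a b, P a → P b → P (a * b)) : P a := by
  obtain ⟨a, ha⟩ := a
  induction ha using Algebra.adjoin_induction with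
  | mem x hx =>
    rcases hx with ⟨i, rfl⟩ | ⟨i, rfl⟩
    · exact XA i
    · exact YA i
  | algebraMap r => exact algebraMap r
  | add x y _ _ hx hy => exact add _ _ hx hy
  | mul x y _ _ hx hy => exact mul _ _ hx hy

/-- The ordered monomial `X_l Y_m` attached to two lists of indices. -/
def orderedMonomial (l m : List I) : Weyl k I := (l.map (XA k I)).prod * (m.map (YA k I)).prod

theorem YA_mul_orderedMonomial_mem_span (i : I) (l m : List I) :
    YA k I i * orderedMonomial l m ∈
      Submodule.span k (Set.range fun q : List I × List I =>
        (orderedMonomial q.1 q.2 : Weyl k I)) := by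
  induction l with
  | nil => exact Submodule.subset_span ⟨([], i :: m), by simp [orderedMonomial]⟩
  | cons j l ih =>
    have hX : ∀ z ∈ Submodule.span k (Set.range fun q : List I × List I =>
        (orderedMonomial q.1 q.2 : Weyl k I)), XA k I j * z ∈
        Submodule.span k (Set.range fun q : List I × List I =>
          (orderedMonomial q.1 q.2 : Weyl k I)) := by
      intro z hz
      induction hz using Submodule.span_induction with
      | mem x hx =>
        obtain ⟨q, rfl⟩ := hx
        exact Submodule.subset_span ⟨(j :: q.1, q.2), by simp [orderedMonomial, mul_assoc]⟩
      | zero => rw [mul_zero]; exact Submodule.zero_mem _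
      | add x y _ _ hx hy => rw [mul_add]; exact Submodule.add_mem _ hx hy
      | smul c x _ hx => rw [mul_smul_comm]; exact Submodule.smul_mem _ _ hx
    have hcons : (orderedMonomial (j :: l) m : Weyl k I) = XA k I j * orderedMonomial l m := by
      simp [orderedMonomial, mul_assoc]
    rw [hcons, ← mul_assoc]
    by_cases hij : i = j
    · subst hij
      rw [YA_mul_XA_self, add_mul, one_mul, mul_assoc]
      exact Submodule.add_mem _ (hX _ ih) (Submodule.subset_span ⟨(l, m), rfl⟩)
    · rw [YA_mul_XA_of_ne hij, mul_assoc]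
      exact hX _ ih

/-- The ordered monomials span the Weyl algebra. -/
theorem mem_span_orderedMonomial (a : Weyl k I) :
    a ∈ Submodule.span k (Set.range fun q : List I × List I =>
      (orderedMonomial q.1 q.2 : Weyl k I)) := by
  set P := Submodule.span k (Set.range fun q : List I × List I =>
    (orderedMonomial q.1 q.2 : Weyl k I)) with hP
  suffices h : ∀ z ∈ P, a * z ∈ P by
    simpa using h 1 (Submodule.subset_span ⟨([], []), by simp [orderedMonomial]⟩)
  induction a using Weyl.induction_on with
  | algebraMap c =>
    intro z hz
    rw [← Algebra.smul_def]
    exact P.smul_mem c hz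
  | XA i =>
    intro z hz
    induction hz using Submodule.span_induction with
    | mem x hx =>
      obtain ⟨q, rfl⟩ := hx
      exact Submodule.subset_span ⟨(i :: q.1, q.2), by simp [orderedMonomial, mul_assoc]⟩
    | zero => rw [mul_zero]; exact Submodule.zero_mem _
    | add x y _ _ hx hy => rw [mul_add]; exact Submodule.add_mem _ hx hy
    | smul c x _ hx => rw [mul_smul_comm]; exact Submodule.smul_mem _ _ hx
  | YA i =>
    intro z hz
    induction hz using Submodule.span_induction with
    | mem x hx =>
      obtain ⟨q, rfl⟩ := hx
      exact YA_mul_orderedMonomial_mem_span i q.1 q.2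
    | zero => rw [mul_zero]; exact Submodule.zero_mem _
    | add x y _ _ hx hy => rw [mul_add]; exact Submodule.add_mem _ hx hy
    | smul c x _ hx => rw [mul_smul_comm]; exact Submodule.smul_mem _ _ hx
  | add a b ha hb =>
    intro z hz
    rw [add_mul]
    exact P.add_mem (ha z hz) (hb z hz)
  | mul a b ha hb =>
    intro z hz
    rw [mul_assoc]
    exact ha _ (hb z hz)

variable {N : Type*} [AddCommGroup N] [Module (Weyl k I) N]

/-- `x` is a weight vector of weight `q`. -/
def IsWt (q : I → k) (x : N) : Prop :=
  ∀ i, tA k I i • x = algebraMap k (Weyl k I) (q i) • x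

theorem smul_algebraMap_smul_comm (a : Weyl k I) (c : k) (x : N) :
    a • algebraMap k (Weyl k I) c • x = algebraMap k (Weyl k I) c • a • x := by
  rw [smul_smul, smul_smul, Algebra.commutes]

/-- The weight `p + v`. -/
def wtShift (p : I → k) (v : I →₀ ℤ) : I → k := fun i => p i + (v i : k)

theorem wtShift_zero (p : I → k) : wtShift p 0 = p := by
  funext i; simp [wtShift]

theorem wtShift_injective [CharZero k] (p : I → k) : Function.Injective (wtShift p) := by
  intro v w h
  ext i
  have := congrFun h i
  simpa [wtShift] using this

theorem IsWt.XA_smul {p : I → k} {v : I →₀ ℤ} {x : N} (h : IsWt (wtShift p v) x) (j : I) :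
    IsWt (wtShift p (v + Finsupp.single j 1)) (XA k I j • x) := by
  intro i
  have hi := h i
  by_cases hij : i = j
  · subst hij
    have ht : tA k I i * XA k I i = XA k I i * tA k I i + XA k I i := by
      rw [tA, mul_assoc, YA_mul_XA_self, mul_add, mul_one]
    rw [smul_smul, ht, add_smul, mul_smul, hi, smul_algebraMap_smul_comm]
    simp [wtShift, ← add_assoc, add_smul]
  · have ht : tA k I i * XA k I j = XA k I j * tA k I i := by
      rw [tA, mul_assoc, YA_mul_XA_of_ne hij, ← mul_assoc, XA_mul_comm, mul_assoc]
    rw [smul_smul, ht, mul_smul, hi, smul_algebraMap_smul_comm]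
    simp [wtShift, Ne.symm hij]

theorem IsWt.YA_smul {p : I → k} {v : I →₀ ℤ} {x : N} (h : IsWt (wtShift p v) x) (j : I) :
    IsWt (wtShift p (v - Finsupp.single j 1)) (YA k I j • x) := by
  intro i
  have hi := h i
  by_cases hij : i = j
  · subst hij
    have ht : tA k I i * YA k I i = YA k I i * tA k I i - YA k I i := by
      rw [tA, ← mul_assoc, YA_mul_XA_self, add_mul, one_mul, add_sub_cancel_right]
    rw [smul_smul, ht, sub_smul, mul_smul, hi, smul_algebraMap_smul_comm]
    simp [wtShift, ← add_sub_assoc, sub_smul]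
  · have ht : tA k I i * YA k I j = YA k I j * tA k I i := by
      rw [tA, mul_assoc, YA_mul_comm, ← mul_assoc, ← YA_mul_XA_of_ne (Ne.symm hij), mul_assoc]
    rw [smul_smul, ht, mul_smul, hi, smul_algebraMap_smul_comm]
    simp [wtShift, Ne.symm hij]

/-- The multidegree of a list of indices. -/
def listDegree (l : List I) : I →₀ ℤ := (l.map fun i => Finsupp.single i 1).sum

theorem listDegree_apply [DecidableEq I] (l : List I) (i : I) : listDegree l i = l.count i := by
  induction l with
  | nil => simp [listDegree]
  | cons j l ih =>
    have : listDegree (j :: l) = Finsupp.single j 1 + listDegree l := by simp [listDegree]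
    rw [this, Finsupp.add_apply, ih, List.count_cons, Finsupp.single_apply]
    by_cases h : j = i <;> simp [h, add_comm]

theorem IsWt.prod_YA_smul {p : I → k} {v : I →₀ ℤ} {x : N} (h : IsWt (wtShift p v) x)
    (m : List I) :
    IsWt (wtShift p (v - listDegree m)) ((m.map (YA k I)).prod • x) := by
  induction m with
  | nil => simpa [listDegree] using h
  | cons j m ih =>
    have h1 : v - listDegree (j :: m) = v - listDegree m - Finsupp.single j 1 := by
      simp [listDegree, sub_sub, add_comm]
    rw [List.map_cons, List.prod_cons, mul_smul, h1]
    exact ih.YA_smul j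

theorem IsWt.prod_XA_smul {p : I → k} {v : I →₀ ℤ} {x : N} (h : IsWt (wtShift p v) x)
    (l : List I) :
    IsWt (wtShift p (v + listDegree l)) ((l.map (XA k I)).prod • x) := by
  induction l with
  | nil => simpa [listDegree] using h
  | cons j l ih =>
    have h1 : v + listDegree (j :: l) = v + listDegree l + Finsupp.single j 1 := by
      simp only [listDegree, List.map_cons, List.sum_cons]
      abel
    rw [List.map_cons, List.prod_cons, mul_smul, h1]
    exact ih.XA_smul j

theorem IsWt.exists_orderedMonomial_reverse_smul_eq {p : I → k} {x : N} (h : IsWt p x)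
    (m : List I) :
    ∃ c : k, (orderedMonomial m.reverse m : Weyl k I) • x = algebraMap k (Weyl k I) c • x := by
  induction m with
  | nil => exact ⟨1, by simp [orderedMonomial]⟩
  | cons i m ih =>
    obtain ⟨c, hc⟩ := ih
    have h0 : IsWt (wtShift p 0) x := by rwa [wtShift_zero]
    have h1 := h0.prod_YA_smul m i
    refine ⟨wtShift p (0 - listDegree m) i * c, ?_⟩
    have h2 : (orderedMonomial (i :: m).reverse (i :: m) : Weyl k I) =
        (m.reverse.map (XA k I)).prod * (tA k I i * (m.map (YA k I)).prod) := by
      simp only [orderedMonomial, tA, List.reverse_cons, List.map_append, List.prod_append,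
        List.map_cons, List.map_nil, List.prod_cons, List.prod_nil, mul_one, mul_assoc]
    rw [h2, mul_smul, mul_smul, h1, smul_algebraMap_smul_comm, map_mul, mul_smul, ← hc,
      orderedMonomial, mul_smul]

theorem orderedMonomial_eq_of_perm {l l' : List I} (h : l.Perm l') (m : List I) :
    (orderedMonomial l m : Weyl k I) = orderedMonomial l' m := by
  rw [orderedMonomial, orderedMonomial]
  congr 1
  refine (h.map _).prod_eq' (List.pairwise_map.mpr ?_)
  exact List.pairwise_of_forall fun x y => XA_mul_comm x y

/-- Weight components can be separated by an element acting diagonally on weight vectors. -/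
theorem exists_separating (N : Type*) [AddCommGroup N] [Module (Weyl k I) N]
    (q : I → k) (F : Finset (I → k)) (hq : q ∉ F) :
    ∃ (b : Weyl k I) (γ : (I → k) → k), γ q ≠ 0 ∧ (∀ q' ∈ F, γ q' = 0) ∧
      ∀ (q' : I → k) (x : N), IsWt q' x → b • x = algebraMap k (Weyl k I) (γ q') • x := by
  classical
  induction F using Finset.induction_on with
  | empty => exact ⟨1, fun _ => 1, one_ne_zero, by simp, by simp⟩
  | insert r F hr ih =>
    rw [Finset.mem_insert, not_or] at hq
    obtain ⟨b, γ, h1, h2, h3⟩ := ih hq.2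
    obtain ⟨i, hi⟩ := Function.ne_iff.mp hq.1
    refine ⟨(tA k I i - algebraMap k (Weyl k I) (r i)) * b, fun q' => (q' i - r i) * γ q',
      mul_ne_zero (sub_ne_zero.mpr hi) h1, fun q' hq' => ?_, fun q' x hx => ?_⟩
    · rcases Finset.mem_insert.mp hq' with rfl | hq'
      · simp
      · simp [h2 q' hq']
    · rw [mul_smul, h3 q' x hx, smul_algebraMap_smul_comm, sub_smul, hx i, ← sub_smul, ← map_sub,
        smul_smul, ← map_mul, mul_comm]

theorem IsWt.exists_smul_decomposition [CharZero k] {p : I → k} {x : N} (hx : IsWt p x)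
    (a : Weyl k I) :
    ∃ (c : k) (F : Finset (I → k)), p ∉ F ∧ ∀ (b : Weyl k I) (γ : (I → k) → k),
      (∀ (q : I → k) (x : N), IsWt q x → b • x = algebraMap k (Weyl k I) (γ q) • x) →
      (∀ q ∈ F, γ q = 0) → b • a • x = algebraMap k (Weyl k I) (γ p * c) • x := by
  classical
  induction mem_span_orderedMonomial a using Submodule.span_induction with
  | mem a ha =>
    obtain ⟨⟨l, m⟩, rfl⟩ := ha
    dsimp only
    by_cases hlm : l.Perm m.reverse
    · obtain ⟨c, hc⟩ := hx.exists_orderedMonomial_reverse_smul_eq m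
      refine ⟨c, ∅, by simp, fun b γ hb _ => ?_⟩
      rw [orderedMonomial_eq_of_perm hlm, hc, smul_algebraMap_smul_comm, hb p x hx, smul_smul,
        ← map_mul, mul_comm]
    · have h0 : IsWt (wtShift p 0) x := by rwa [wtShift_zero]
      have h1 := (h0.prod_YA_smul m).prod_XA_smul l
      rw [smul_smul] at h1
      refine ⟨0, {wtShift p (0 - listDegree m + listDegree l)}, ?_, fun b γ hb hF => ?_⟩
      · rw [Finset.mem_singleton]
        intro h
        have h2 := wtShift_injective p ((wtShift_zero p).trans h)
        apply hlm
        rw [List.perm_iff_count]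
        intro i
        have h3 := DFunLike.congr_fun h2 i
        rw [Finsupp.add_apply, Finsupp.sub_apply, Finsupp.zero_apply, listDegree_apply,
          listDegree_apply] at h3
        rw [List.count_reverse]
        omega
      · rw [orderedMonomial, hb _ _ h1, hF _ (Finset.mem_singleton_self _)]
        simp
  | zero => exact ⟨0, ∅, by simp, by simp⟩
  | add a a' _ _ ha ha' =>
    obtain ⟨c, F, h1, h2⟩ := ha
    obtain ⟨c', F', h1', h2'⟩ := ha'
    refine ⟨c + c', F ∪ F', by simp [h1, h1'], fun b γ hb hF => ?_⟩
    rw [add_smul, smul_add, h2 b γ hb fun q hq => hF q (Finset.mem_union_left _ hq),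
      h2' b γ hb fun q hq => hF q (Finset.mem_union_right _ hq), ← add_smul, ← map_add, mul_add]
  | smul d a _ ha =>
    obtain ⟨c, F, h1, h2⟩ := ha
    refine ⟨d * c, F, h1, fun b γ hb hF => ?_⟩
    rw [Algebra.smul_def, mul_smul, smul_algebraMap_smul_comm, h2 b γ hb hF, smul_smul, ← map_mul,
      mul_left_comm]

/-- The weight space of weight `p` in the module generated by a weight vector of weight `p` is a
line. -/
theorem IsWt.exists_smul_eq_of_isWt_smul [CharZero k] {p : I → k} {x : N} (hx : IsWt p x)
    {a : Weyl k I} (ha : IsWt p (a • x)) : ∃ c : k, a • x = algebraMap k (Weyl k I) c • x := by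
  obtain ⟨c, F, hF, h⟩ := hx.exists_smul_decomposition a
  obtain ⟨b, γ, h1, h2, h3⟩ := exists_separating N p F hF
  refine ⟨c, ?_⟩
  have h4 := h b γ h3 h2
  rw [h3 p _ ha, map_mul, mul_smul] at h4
  have h5 := congrArg (fun z => algebraMap k (Weyl k I) (γ p)⁻¹ • z) h4
  simpa only [smul_smul, ← map_mul, ← mul_assoc, inv_mul_cancel₀ h1, map_one, one_smul,
    one_mul] using h5

/-- Two modules which are generated by any of their nonzero vectors and which share a weight are
isomorphic. -/
theorem nonempty_linearEquiv_of_isWt [CharZero k] {M L : Type*} [AddCommGroup M]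
    [Module (Weyl k I) M] [AddCommGroup L] [Module (Weyl k I) L] {p : I → k} {x : M} {y : L}
    (hx : IsWt p x) (hy : IsWt p y) (hx0 : x ≠ 0) (hy0 : y ≠ 0)
    (hM : ∀ m m' : M, m ≠ 0 → ∃ a : Weyl k I, a • m = m')
    (hL : ∀ m m' : L, m ≠ 0 → ∃ a : Weyl k I, a • m = m') :
    Nonempty (M ≃ₗ[Weyl k I] L) := by
  have hxy : IsWt p ((x, y) : M × L) := fun i => Prod.ext (hx i) (hy i)
  have key : LinearMap.ker (LinearMap.toSpanSingleton (Weyl k I) M x) =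
      LinearMap.ker (LinearMap.toSpanSingleton (Weyl k I) L y) := by
    ext a
    rw [LinearMap.mem_ker, LinearMap.mem_ker, LinearMap.toSpanSingleton_apply,
      LinearMap.toSpanSingleton_apply]
    constructor
    · intro ha
      by_contra hay
      obtain ⟨b, hb⟩ := hL _ y hay
      have h1 : (b * a) • ((x, y) : M × L) = (0, y) := by
        rw [Prod.smul_mk, mul_smul, mul_smul, ha, hb, smul_zero]
      obtain ⟨c, hc⟩ := hxy.exists_smul_eq_of_isWt_smul (a := b * a)
        (by rw [h1]; exact fun i => Prod.ext (by simp) (hy i))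
      rw [h1, Prod.smul_mk, Prod.mk.injEq] at hc
      by_cases hc0 : c = 0
      · simp only [hc0, map_zero, zero_smul] at hc
        exact hy0 hc.2
      · apply hx0
        rw [← one_smul (Weyl k I) x, ← map_one (algebraMap k (Weyl k I)), ← inv_mul_cancel₀ hc0,
          map_mul, mul_smul, ← hc.1, smul_zero]
    · intro ha
      by_contra hax
      obtain ⟨b, hb⟩ := hM _ x hax
      have h1 : (b * a) • ((x, y) : M × L) = (x, 0) := by
        rw [Prod.smul_mk, mul_smul, mul_smul, ha, hb, smul_zero]
      obtain ⟨c, hc⟩ := hxy.exists_smul_eq_of_isWt_smul (a := b * a)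
        (by rw [h1]; exact fun i => Prod.ext (hx i) (by simp))
      rw [h1, Prod.smul_mk, Prod.mk.injEq] at hc
      by_cases hc0 : c = 0
      · simp only [hc0, map_zero, zero_smul] at hc
        exact hx0 hc.1
      · apply hy0
        rw [← one_smul (Weyl k I) y, ← map_one (algebraMap k (Weyl k I)), ← inv_mul_cancel₀ hc0,
          map_mul, mul_smul, ← hc.2, smul_zero]
  exact ⟨((LinearMap.toSpanSingleton (Weyl k I) M x).quotKerEquivOfSurjective
      fun m => hM x m hx0).symm ≪≫ₗ Submodule.quotEquivOfEq _ _ key ≪≫ₗ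
    (LinearMap.toSpanSingleton (Weyl k I) L y).quotKerEquivOfSurjective fun m => hL y m hy0⟩

end Weights

section Simple

variable {k I}

theorem IsNonnegInt.add_natCast {c : k} (h : IsNonnegInt k c) (n : ℕ) :
    IsNonnegInt k (c + n) := by
  obtain ⟨m, rfl⟩ := h
  exact ⟨m + n, by push_cast; ring⟩

theorem IsNonnegInt.eq_zero_or_sub_one {c : k} (h : IsNonnegInt k c) :
    c = 0 ∨ IsNonnegInt k (c - 1) := by
  obtain ⟨m, rfl⟩ := h
  rcases m with _ | m
  · exact Or.inl (by simp)
  · exact Or.inr ⟨m, by push_cast; ring⟩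

theorem not_isNonnegInt_of_neg [CharZero k] {m : ℤ} (hm : m < 0) : ¬ IsNonnegInt k (m : k) := by
  rintro ⟨n, hn⟩
  have : m = n := by exact_mod_cast hn
  omega

/-- The condition on the `i`-th coordinate defining the weights `p + v` of `L(p)`. -/
def IsAdmissible (c : k) (n : ℤ) : Prop :=
  (IsNonnegInt k c → IsNonnegInt k (c + n)) ∧ (IsNegInt k c → ¬ IsNonnegInt k (c + n))

theorem isAdmissible_zero [CharZero k] (c : k) : IsAdmissible c 0 := by
  refine ⟨fun h => by simpa using h, ?_⟩
  rintro ⟨m, hm, rfl⟩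
  simpa using not_isNonnegInt_of_neg hm

theorem IsAdmissible.of_le_of_le {c : k} {l m n : ℤ} (hl : IsAdmissible c l)
    (hn : IsAdmissible c n) (hlm : l ≤ m) (hmn : m ≤ n) : IsAdmissible c m := by
  refine ⟨fun h => ?_, fun h h' => hn.2 h ?_⟩
  · have h1 := (hl.1 h).add_natCast (m - l).toNat
    have h2 : (((m - l).toNat : ℤ) : k) = ((m - l : ℤ) : k) := by rw [Int.toNat_of_nonneg (by omega)]
    rw [Int.cast_natCast] at h2
    rw [h2] at h1
    convert h1 using 1
    push_cast
    ring
  · have h1 := h'.add_natCast (n - m).toNat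
    have h2 : (((n - m).toNat : ℤ) : k) = ((n - m : ℤ) : k) := by rw [Int.toNat_of_nonneg (by omega)]
    rw [Int.cast_natCast] at h2
    rw [h2] at h1
    convert h1 using 1
    push_cast
    ring

theorem IsAdmissible.add_ne_zero [CharZero k] {c : k} {n : ℤ} (hn : IsAdmissible c n)
    (hn' : IsAdmissible c (n - 1)) : c + n ≠ 0 := by
  intro h
  have hc : c = ((-n : ℤ) : k) := by
    push_cast
    exact eq_neg_of_add_eq_zero_left h
  rcases lt_or_ge (-n) 0 with h0 | h0
  · exact hn.2 ⟨-n, h0, hc⟩ ⟨0, by simpa using h⟩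
  · have h1 : IsNonnegInt k c := ⟨(-n).toNat, by
      rw [hc, ← Int.cast_natCast (R := k), Int.toNat_of_nonneg h0]⟩
    have h2 := hn'.1 h1
    have h3 : c + ((n - 1 : ℤ) : k) = ((-1 : ℤ) : k) := by
      push_cast
      rw [← add_sub_assoc, h, zero_sub]
    rw [h3] at h2
    exact not_isNonnegInt_of_neg (by norm_num) h2

theorem mem_Sset_diff_iff {p : I → k} {v : I →₀ ℤ} :
    v ∈ Sset k I p ∧ v ∉ Sset'' k I p ↔ ∀ i, IsAdmissible (p i) (v i) := by
  constructor
  · rintro ⟨h1, h2⟩ i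
    exact ⟨h1 i, fun h h' => h2 ⟨h1, i, h, h'⟩⟩
  · intro h
    exact ⟨fun i => (h i).1, fun ⟨_, i, h1, h2⟩ => (h i).2 h1 h2⟩

theorem add_single_mem_Sset {p : I → k} {v : I →₀ ℤ} (h : v ∈ Sset k I p) (i : I) :
    v + Finsupp.single i 1 ∈ Sset k I p := by
  intro j hj
  by_cases hij : i = j
  · subst hij
    simpa [add_assoc] using (h i hj).add_natCast 1
  · simpa [hij] using h j hj

theorem add_single_mem_Sset'' {p : I → k} {v : I →₀ ℤ} (h : v ∈ Sset'' k I p) (i : I) :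
    v + Finsupp.single i 1 ∈ Sset'' k I p := by
  obtain ⟨h1, j, h2, h3⟩ := h
  refine ⟨add_single_mem_Sset h1 i, j, h2, ?_⟩
  by_cases hij : i = j
  · subst hij
    simpa [add_assoc] using h3.add_natCast 1
  · simpa [hij] using h3

theorem sub_single_mem_Sset {p : I → k} {v : I →₀ ℤ} (h : v ∈ Sset k I p) {i : I}
    (hi : p i + (v i : k) ≠ 0) : v - Finsupp.single i 1 ∈ Sset k I p := by
  intro j hj
  by_cases hij : i = j
  · subst hij
    simpa [add_sub_assoc] using (h i hj).eq_zero_or_sub_one.resolve_left hi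
  · simpa [hij] using h j hj

theorem sub_single_mem_Sset'' {p : I → k} {v : I →₀ ℤ} (h : v ∈ Sset'' k I p) {i : I}
    (hi : p i + (v i : k) ≠ 0) : v - Finsupp.single i 1 ∈ Sset'' k I p := by
  obtain ⟨h1, j, h2, h3⟩ := h
  refine ⟨sub_single_mem_Sset h1 hi, j, h2, ?_⟩
  by_cases hij : i = j
  · subst hij
    simpa [add_sub_assoc] using h3.eq_zero_or_sub_one.resolve_left hi
  · simpa [hij] using h3

variable {p : I → k} {ρ : Weyl k I →ₐ[k] Module.End k ((I →₀ ℤ) →₀ k)}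

theorem XA_smul_eV (hX : ∀ i, ρ (XA k I i) = Sop k I i) (i : I) (v : I →₀ ℤ) :
    XA k I i • eV k I ρ v = eV k I ρ (v + Finsupp.single i 1) := by
  change ρ (XA k I i) (Finsupp.single v 1) = Finsupp.single (v + Finsupp.single i 1) 1
  rw [hX, Sop_single]

theorem YA_smul_eV (hY : ∀ i, ρ (YA k I i) = Dop k I p i) (i : I) (v : I →₀ ℤ) :
    YA k I i • eV k I ρ v = (p i + (v i : k)) • eV k I ρ (v - Finsupp.single i 1) := by
  change ρ (YA k I i) (Finsupp.single v 1) =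
    (p i + (v i : k)) • Finsupp.single (v - Finsupp.single i 1) (1 : k)
  rw [hY, Dop_single, Finsupp.smul_single, one_mul, smul_eq_mul, mul_one]

theorem smul_smul_comm_BMod (a : Weyl k I) (c : k) (x : BMod k I ρ) : a • c • x = c • a • x :=
  map_smul (ρ a) c x

theorem isWt_eV (hX : ∀ i, ρ (XA k I i) = Sop k I i) (hY : ∀ i, ρ (YA k I i) = Dop k I p i)
    (v : I →₀ ℤ) : IsWt (wtShift p v) (eV k I ρ v) := by
  intro i
  rw [tA, mul_smul, YA_smul_eV hY, smul_smul_comm_BMod, XA_smul_eV hX, sub_add_cancel,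
    algebraMap_smul]
  rfl

/-- A subspace of `B(p)` stable under the generators is a submodule over the Weyl algebra. -/
theorem exists_submodule_coe_eq (P : Submodule k (BMod k I ρ))
    (hX : ∀ i, ∀ x ∈ P, XA k I i • x ∈ P) (hY : ∀ i, ∀ x ∈ P, YA k I i • x ∈ P) :
    ∃ Q : Submodule (Weyl k I) (BMod k I ρ), (Q : Set (BMod k I ρ)) = P := by
  refine ⟨{ P.toAddSubmonoid with smul_mem' := fun a => ?_ }, rfl⟩
  change ∀ {x}, x ∈ P → a • x ∈ P
  induction a using Weyl.induction_on with
  | algebraMap c =>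
    intro x hx
    rw [algebraMap_smul]
    exact P.smul_mem c hx
  | XA i => exact fun hx => hX i _ hx
  | YA i => exact fun hx => hY i _ hx
  | add a b ha hb =>
    intro x hx
    rw [add_smul]
    exact P.add_mem (ha hx) (hb hx)
  | mul a b ha hb =>
    intro x hx
    rw [mul_smul]
    exact ha (hb hx)

/-- A span of basis vectors whose index set is suitably closed under shifts is a submodule. -/
theorem exists_submodule_coe_eq_span (hX : ∀ i, ρ (XA k I i) = Sop k I i)
    (hY : ∀ i, ρ (YA k I i) = Dop k I p i) (S : Set (I →₀ ℤ))
    (hup : ∀ v ∈ S, ∀ i, v + Finsupp.single i 1 ∈ S)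
    (hdown : ∀ v ∈ S, ∀ i, p i + (v i : k) ≠ 0 → v - Finsupp.single i 1 ∈ S) :
    ∃ Q : Submodule (Weyl k I) (BMod k I ρ), (Q : Set (BMod k I ρ)) =
      Submodule.span k {x | ∃ v ∈ S, x = eV k I ρ v} := by
  refine exists_submodule_coe_eq _ (fun i x hx => ?_) (fun i x hx => ?_)
  · induction hx using Submodule.span_induction with
    | mem x hx =>
      obtain ⟨v, hv, rfl⟩ := hx
      rw [XA_smul_eV hX]
      exact Submodule.subset_span ⟨_, hup v hv i, rfl⟩
    | zero => rw [smul_zero]; exact Submodule.zero_mem _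
    | add x y _ _ hx hy => rw [smul_add]; exact Submodule.add_mem _ hx hy
    | smul c x _ hx => rw [smul_smul_comm_BMod]; exact Submodule.smul_mem _ _ hx
  · induction hx using Submodule.span_induction with
    | mem x hx =>
      obtain ⟨v, hv, rfl⟩ := hx
      rw [YA_smul_eV hY]
      by_cases h0 : p i + (v i : k) = 0
      · rw [h0, zero_smul]
        exact Submodule.zero_mem _
      · exact Submodule.smul_mem _ _ (Submodule.subset_span ⟨_, hdown v hv i h0, rfl⟩)
    | zero => rw [smul_zero]; exact Submodule.zero_mem _
    | add x y _ _ hx hy => rw [smul_add]; exact Submodule.add_mem _ hx hy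
    | smul c x _ hx => rw [smul_smul_comm_BMod]; exact Submodule.smul_mem _ _ hx

theorem mem_span_eV_iff (S : Set (I →₀ ℤ)) (x : (I →₀ ℤ) →₀ k) :
    (show BMod k I ρ from x) ∈ Submodule.span k {x | ∃ v ∈ S, x = eV k I ρ v} ↔
      ∀ v, x v ≠ 0 → v ∈ S := by
  have h : {x | ∃ v ∈ S, x = eV k I ρ v} =
      (fun v => (Finsupp.single v (1 : k) : (I →₀ ℤ) →₀ k)) '' S := by
    ext y
    exact ⟨fun ⟨v, hv, h⟩ => ⟨v, hv, h.symm⟩, fun ⟨v, hv, h⟩ => ⟨v, hv, h.symm⟩⟩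
  rw [h]
  change x ∈ Submodule.span k ((fun v => (Finsupp.single v (1 : k) : (I →₀ ℤ) →₀ k)) '' S) ↔ _
  rw [← Finsupp.supported_eq_span_single, Finsupp.mem_supported]
  constructor
  · exact fun h v hv => h (Finsupp.mem_support_iff.mpr hv)
  · exact fun h v hv => h v (Finsupp.mem_support_iff.mp hv)

theorem exists_smul_eV_eq_add_single [CharZero k] (hX : ∀ i, ρ (XA k I i) = Sop k I i)
    (hY : ∀ i, ρ (YA k I i) = Dop k I p i) (i : I) (d : ℤ) (v : I →₀ ℤ)
    (hv : IsAdmissible (p i) (v i)) (hvd : IsAdmissible (p i) (v i + d)) :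
    ∃ a : Weyl k I, a • eV k I ρ v = eV k I ρ (v + Finsupp.single i d) := by
  induction d using Int.induction_on with
  | zero => exact ⟨1, by simp⟩
  | succ n ih =>
    obtain ⟨a, ha⟩ := ih (hv.of_le_of_le hvd (by omega) (by omega))
    refine ⟨XA k I i * a, ?_⟩
    rw [mul_smul, ha, XA_smul_eV hX, add_assoc, ← Finsupp.single_add]
  | pred n ih =>
    have h1 : IsAdmissible (p i) (v i + -n) := hvd.of_le_of_le hv (by omega) (by omega)
    obtain ⟨a, ha⟩ := ih h1
    have h2 : p i + ((v i + -n : ℤ) : k) ≠ 0 := h1.add_ne_zero (by rwa [add_sub_assoc])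
    refine ⟨algebraMap k _ (p i + ((v i + -n : ℤ) : k))⁻¹ * (YA k I i * a), ?_⟩
    rw [mul_smul, mul_smul, ha, YA_smul_eV hY, algebraMap_smul, Finsupp.add_apply,
      Finsupp.single_eq_same, smul_smul, inv_mul_cancel₀ h2, one_smul, add_sub_assoc,
      ← Finsupp.single_sub]

theorem exists_smul_eV_eq_add [CharZero k] (hX : ∀ i, ρ (XA k I i) = Sop k I i)
    (hY : ∀ i, ρ (YA k I i) = Dop k I p i) (d v : I →₀ ℤ)
    (hv : ∀ i, IsAdmissible (p i) (v i)) (hvd : ∀ i, IsAdmissible (p i) ((v + d) i)) :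
    ∃ a : Weyl k I, a • eV k I ρ v = eV k I ρ (v + d) := by
  induction d using Finsupp.induction generalizing v with
  | zero => exact ⟨1, by simp⟩
  | single_add i n f hi hn ih =>
    have h1 := hvd i
    rw [Finsupp.add_apply, Finsupp.add_apply, Finsupp.single_eq_same,
      Finsupp.notMem_support_iff.mp hi, add_zero] at h1
    obtain ⟨a, ha⟩ := exists_smul_eV_eq_add_single hX hY i n v (hv i) h1
    obtain ⟨b, hb⟩ := ih (v + Finsupp.single i n)
      (fun j => by
        by_cases hij : i = j
        · subst hij
          simpa using h1
        · simpa [hij] using hv j)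
      (fun j => by rw [add_assoc]; exact hvd j)
    exact ⟨b * a, by rw [mul_smul, ha, hb, add_assoc]⟩

theorem exists_smul_eq_eV [CharZero k] (hX : ∀ i, ρ (XA k I i) = Sop k I i)
    (hY : ∀ i, ρ (YA k I i) = Dop k I p i) (z : (I →₀ ℤ) →₀ k) {v : I →₀ ℤ} (hv : z v ≠ 0) :
    ∃ a : Weyl k I, a • (show BMod k I ρ from z) = eV k I ρ v := by
  classical
  obtain ⟨b, γ, h1, h2, h3⟩ := exists_separating (BMod k I ρ) (wtShift p v)
    ((z.support.erase v).image (wtShift p)) (by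
      rw [Finset.mem_image]
      rintro ⟨u, hu, huv⟩
      exact Finset.ne_of_mem_erase hu (wtShift_injective p huv))
  have hsum : z = ∑ u ∈ z.support, z u • Finsupp.single u (1 : k) := by
    simpa [Finsupp.sum] using (Finsupp.sum_single z).symm
  have hz : (show BMod k I ρ from z) = ∑ u ∈ z.support, z u • eV k I ρ u := hsum
  have hb : b • (show BMod k I ρ from z) = (z v * γ (wtShift p v)) • eV k I ρ v := by
    refine (congrArg (b • ·) hz).trans ?_
    rw [Finset.smul_sum, Finset.sum_eq_single v]
    · rw [smul_smul_comm_BMod, h3 _ _ (isWt_eV hX hY v), algebraMap_smul, smul_smul]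
    · intro u hu huv
      rw [smul_smul_comm_BMod, h3 _ _ (isWt_eV hX hY u),
        h2 _ (Finset.mem_image_of_mem _ (Finset.mem_erase.mpr ⟨huv, hu⟩)), map_zero, zero_smul,
        smul_zero]
    · exact fun h => absurd (Finsupp.mem_support_iff.mpr hv) h
  refine ⟨algebraMap k _ (z v * γ (wtShift p v))⁻¹ * b, ?_⟩
  rw [mul_smul, hb, algebraMap_smul, smul_smul, inv_mul_cancel₀ (mul_ne_zero hv h1), one_smul]

/-- Modulo `N''`, every vector of `N` outside `N''` generates `N`. -/
theorem exists_smul_sub_mem_Nspan'' [CharZero k] (hX : ∀ i, ρ (XA k I i) = Sop k I i)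
    (hY : ∀ i, ρ (YA k I i) = Dop k I p i) {z z' : BMod k I ρ} (hz : z ∈ Nspan k I p ρ)
    (hz'' : z ∉ Nspan'' k I p ρ) (hz' : z' ∈ Nspan k I p ρ) :
    ∃ a : Weyl k I, a • z - z' ∈ Nspan'' k I p ρ := by
  have hzS := (mem_span_eV_iff (ρ := ρ) (Sset k I p) z).mp hz
  have hzS'' := mt (mem_span_eV_iff (ρ := ρ) (Sset'' k I p) z).mpr hz''
  push Not at hzS''
  obtain ⟨v, hv0, hv⟩ := hzS''
  have hvT := mem_Sset_diff_iff.mp ⟨hzS v hv0, hv⟩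
  obtain ⟨b, hb⟩ := exists_smul_eq_eV hX hY z hv0
  induction hz' using Submodule.span_induction with
  | mem x hx =>
    obtain ⟨w, hw, rfl⟩ := hx
    by_cases hw'' : w ∈ Sset'' k I p
    · refine ⟨0, ?_⟩
      rw [zero_smul, zero_sub]
      exact Submodule.neg_mem _ (Submodule.subset_span ⟨w, hw'', rfl⟩)
    · obtain ⟨a, ha⟩ := exists_smul_eV_eq_add hX hY (w - v) v hvT
        (by rw [add_sub_cancel]; exact mem_Sset_diff_iff.mp ⟨hw, hw''⟩)
      refine ⟨a * b, ?_⟩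
      rw [add_sub_cancel] at ha
      rw [mul_smul]
      erw [hb]
      rw [ha, sub_self]
      exact Submodule.zero_mem _
  | zero => exact ⟨0, by rw [zero_smul, sub_zero]; exact Submodule.zero_mem _⟩
  | add x y _ _ hx hy =>
    obtain ⟨a, ha⟩ := hx
    obtain ⟨a', ha'⟩ := hy
    refine ⟨a + a', ?_⟩
    rw [add_smul, add_sub_add_comm]
    exact Submodule.add_mem _ ha ha'
  | smul c x _ hx =>
    obtain ⟨a, ha⟩ := hx
    refine ⟨algebraMap k _ c * a, ?_⟩
    rw [mul_smul, algebraMap_smul, ← smul_sub]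
    exact Submodule.smul_mem _ _ ha

end Simple

/-- Every simple weight module over the Weyl algebra is isomorphic to
`L(p) = N_p ⧸ N''_p` for some `p : I → k`. -/
theorem simple_weight_module_iso_Lp [IsAlgClosed k] [CharZero k] [Infinite I]
    (M : Type w) [AddCommGroup M] [Module (Weyl k I) M] [Module k M]
    [IsScalarTower k (Weyl k I) M]
    (hsimple : IsSimpleModule (Weyl k I) M)
    (hwt : (⨆ q : I → k, wtSp k I M q) = ⊤) :
    ∃ (p : I → k) (ρ : Weyl k I →ₐ[k] Module.End k ((I →₀ ℤ) →₀ k)),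
      (∀ i, ρ (XA k I i) = Sop k I i) ∧ (∀ i, ρ (YA k I i) = Dop k I p i) ∧
      ∃ NA NA'' : Submodule (Weyl k I) (BMod k I ρ),
        (NA : Set (BMod k I ρ)) = (Nspan k I p ρ : Set (BMod k I ρ)) ∧
        (NA'' : Set (BMod k I ρ)) = (Nspan'' k I p ρ : Set (BMod k I ρ)) ∧
        Nonempty (M ≃ₗ[Weyl k I] (NA ⧸ Submodule.comap NA.subtype NA'')) := by
  have hnt : Nontrivial M := IsSimpleModule.nontrivial (Weyl k I) M
  obtain ⟨p, x, hx, hx0⟩ : ∃ (p : I → k) (x : M), x ∈ wtSp k I M p ∧ x ≠ 0 := by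
    by_contra! h
    have hbot : (⨆ q : I → k, wtSp k I M q) = ⊥ :=
      iSup_eq_bot.mpr fun q => (Submodule.eq_bot_iff _).mpr (h q)
    obtain ⟨y, hy⟩ := exists_ne (0 : M)
    exact hy ((Submodule.mem_bot k).mp (hbot ▸ hwt ▸ Submodule.mem_top))
  have hxp : IsWt p x := fun i => by rw [algebraMap_smul]; exact hx i
  obtain ⟨ρ, hX, hY⟩ := exists_shiftRep p
  obtain ⟨NA, hNA⟩ := exists_submodule_coe_eq_span hX hY (Sset k I p)
    (fun v hv i => add_single_mem_Sset hv i) (fun v hv i hi => sub_single_mem_Sset hv hi)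
  obtain ⟨NA'', hNA''⟩ := exists_submodule_coe_eq_span hX hY (Sset'' k I p)
    (fun v hv i => add_single_mem_Sset'' hv i) (fun v hv i hi => sub_single_mem_Sset'' hv hi)
  have hmem : ∀ z, z ∈ NA ↔ z ∈ Nspan k I p ρ := fun z => Set.ext_iff.mp hNA z
  have hmem'' : ∀ z, z ∈ NA'' ↔ z ∈ Nspan'' k I p ρ := fun z => Set.ext_iff.mp hNA'' z
  refine ⟨p, ρ, hX, hY, NA, NA'', hNA, hNA'', ?_⟩
  have h0 : (0 : I →₀ ℤ) ∈ Sset k I p ∧ (0 : I →₀ ℤ) ∉ Sset'' k I p :=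
    mem_Sset_diff_iff.mpr fun i => isAdmissible_zero (p i)
  have he : eV k I ρ 0 ∈ NA := (hmem _).mpr (Submodule.subset_span ⟨0, h0.1, rfl⟩)
  have he'' : eV k I ρ 0 ∉ NA'' := by
    rw [hmem'']
    intro h
    refine h0.2 ((mem_span_eV_iff (ρ := ρ) _ _).mp h 0 ?_)
    change (Finsupp.single 0 1 : (I →₀ ℤ) →₀ k) 0 ≠ 0
    rw [Finsupp.single_eq_same]
    exact one_ne_zero
  refine nonempty_linearEquiv_of_isWt (p := p) (x := x)
    (y := Submodule.Quotient.mk (⟨eV k I ρ 0, he⟩ : NA)) hxp (fun i => ?_) hx0 ?_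
    (fun m m' hm => IsSimpleModule.toSpanSingleton_surjective (Weyl k I) hm m') ?_
  · have h1 := isWt_eV hX hY 0 i
    rw [wtShift_zero] at h1
    rw [← Submodule.Quotient.mk_smul, ← Submodule.Quotient.mk_smul]
    exact congrArg _ (Subtype.ext h1)
  · rwa [Ne, Submodule.Quotient.mk_eq_zero]
  · intro m m' hm
    obtain ⟨⟨z, hz⟩, rfl⟩ := Submodule.Quotient.mk_surjective _ m
    obtain ⟨⟨z', hz'⟩, rfl⟩ := Submodule.Quotient.mk_surjective _ m'
    have hz'' : z ∉ NA'' := fun h => hm ((Submodule.Quotient.mk_eq_zero _).mpr h)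
    obtain ⟨a, ha⟩ := exists_smul_sub_mem_Nspan'' hX hY ((hmem z).mp hz)
      (fun h => hz'' ((hmem'' z).mpr h)) ((hmem z').mp hz')
    refine ⟨a, ?_⟩
    rw [← Submodule.Quotient.mk_smul, Submodule.Quotient.eq]
    exact (hmem'' _).mpr ha
end
end

section
/- For each i ∈ I, the adjoint action of X_i on A is locally nilpotent: for every a ∈ A there exists n such that the n-fold iterated commutator ad(X_i)^n(a) = 0, where ad(X_i)(a) = X_i·a − a·X_i. Consequently, for any subset J ⊆ I the multiplicative submonoid T of A generated by {X_i : i ∈ J} is a left and right Ore set in A: for every a ∈ A and s ∈ T there exist b ∈ A and t ∈ T with t·a = b·s, and there exist b' ∈ A and t' ∈ T with a·t' = s·b'. -/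
set_option synthInstance.maxHeartbeats 1000000
set_option maxHeartbeats 4000000

noncomputable section

open MvPolynomial

universe u v

variable (k : Type u) (I : Type v) [Field k]

section Ore

variable {M : Type*} [Monoid M] {S : Set M}

theorem left_ore_closure (h : ∀ x ∈ S, ∀ a, ∃ b, ∃ t ∈ Submonoid.closure S, t * a = b * x)
    {s : M} (hs : s ∈ Submonoid.closure S) (a : M) :
    ∃ b, ∃ t ∈ Submonoid.closure S, t * a = b * s := by
  induction hs using Submonoid.closure_induction generalizing a with
  | mem x hx => exact h x hx a
  | one => exact ⟨a, 1, one_mem _, by simp⟩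
  | mul y z _ _ ihy ihz =>
    obtain ⟨b, t, ht, htb⟩ := ihz a
    obtain ⟨c, u, hu, huc⟩ := ihy b
    exact ⟨c, u * t, mul_mem hu ht, by rw [mul_assoc, htb, ← mul_assoc, huc, mul_assoc]⟩

theorem right_ore_closure (h : ∀ x ∈ S, ∀ a, ∃ b, ∃ t ∈ Submonoid.closure S, a * t = x * b)
    {s : M} (hs : s ∈ Submonoid.closure S) (a : M) :
    ∃ b, ∃ t ∈ Submonoid.closure S, a * t = s * b := by
  induction hs using Submonoid.closure_induction generalizing a with
  | mem x hx => exact h x hx a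
  | one => exact ⟨a, 1, one_mem _, by simp⟩
  | mul y z _ _ ihy ihz =>
    obtain ⟨b, t, ht, htb⟩ := ihy a
    obtain ⟨c, u, hu, huc⟩ := ihz b
    exact ⟨c, t * u, mul_mem ht hu, by rw [← mul_assoc, htb, mul_assoc, huc, mul_assoc]⟩

end Ore

section LocallyNilpotent

attribute [local instance] LieRing.ofAssociativeRing

variable {F A : Type*} [CommRing F] [Ring A] [Algebra F A]

theorem ad_pow_add_mul_eq_zero (x : A) (n m : ℕ) (a b : A)
    (ha : (LieAlgebra.ad F A x ^ n) a = 0) (hb : (LieAlgebra.ad F A x ^ m) b = 0) :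
    (LieAlgebra.ad F A x ^ (n + m)) (a * b) = 0 := by
  induction n generalizing a b m with
  | zero => simp_all
  | succ n ihn =>
    induction m generalizing a b with
    | zero => simp_all
    | succ m ihm =>
      have leibniz : ⁅x, a * b⁆ = ⁅x, a⁆ * b + a * ⁅x, b⁆ := by
        simp only [Ring.lie_def]; noncomm_ring
      have h₁ : (LieAlgebra.ad F A x ^ (n + (m + 1))) (⁅x, a⁆ * b) = 0 :=
        ihn (m + 1) _ b (by simpa [pow_succ] using ha) hb
      have h₂ : (LieAlgebra.ad F A x ^ (n + 1 + m)) (a * ⁅x, b⁆) = 0 :=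
        ihm a _ ha (by simpa [pow_succ] using hb)
      have split : n + 1 + (m + 1) = n + (m + 1) + 1 := by omega
      rw [split, pow_succ, Module.End.mul_apply, LieAlgebra.ad_apply, leibniz, map_add, h₁,
        zero_add, show n + (m + 1) = n + 1 + m by omega, h₂]

theorem exists_pow_mul_eq_mul_of_ad_pow_eq_zero (x : A) (n : ℕ) (a : A)
    (h : (LieAlgebra.ad F A x ^ n) a = 0) : ∃ b, x ^ n * a = b * x := by
  induction n generalizing a with
  | zero => exact ⟨0, by simp_all⟩
  | succ n ih =>
    obtain ⟨b, hb⟩ := ih ⁅x, a⁆ (by simpa [pow_succ] using h)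
    refine ⟨b + x ^ n * a, ?_⟩
    rw [add_mul, ← hb, Ring.lie_def, pow_succ]
    noncomm_ring

theorem exists_mul_pow_eq_mul_of_ad_pow_eq_zero (x : A) (n : ℕ) (a : A)
    (h : (LieAlgebra.ad F A x ^ n) a = 0) : ∃ b, a * x ^ n = x * b := by
  induction n generalizing a with
  | zero => exact ⟨0, by simp_all⟩
  | succ n ih =>
    obtain ⟨b, hb⟩ := ih ⁅x, a⁆ (by simpa [pow_succ] using h)
    refine ⟨a * x ^ n - b, ?_⟩
    rw [mul_sub, ← hb, Ring.lie_def, pow_succ']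
    noncomm_ring

theorem lie_Xop_Xop (i j : I) : ⁅Xop k I i, Xop k I j⁆ = 0 := by
  refine LinearMap.ext fun p => ?_
  simp only [Ring.lie_def, Xop, LinearMap.sub_apply, Module.End.mul_apply,
    LinearMap.mulLeft_apply, LinearMap.zero_apply]
  ring

open Classical in
theorem lie_Xop_Yop (i j : I) :
    ⁅Xop k I i, Yop k I j⁆ =
      algebraMap k (Module.End k (MvPolynomial I k)) (-(Pi.single i 1 : I → k) j) := by
  refine LinearMap.ext fun p => ?_
  rcases eq_or_ne i j with rfl | h
  · simp [Ring.lie_def, Xop, Yop]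
  · simp [Ring.lie_def, Xop, Yop, pderiv_X, h]

theorem exists_ad_XA_pow_eq_zero (i : I) (a : Weyl k I) :
    ∃ n : ℕ, (LieAlgebra.ad k (Weyl k I) (XA k I i) ^ n) a = 0 := by
  rw [← LieSubalgebra.mem_engel_iff]
  obtain ⟨a, ha⟩ := a
  induction ha using Algebra.adjoin_induction with
  | mem x hx =>
    rw [LieSubalgebra.mem_engel_iff]
    refine ⟨2, ?_⟩
    rw [pow_two, Module.End.mul_apply, LieAlgebra.ad_apply, LieAlgebra.ad_apply]
    refine Subtype.ext ?_
    change ⁅Xop k I i, ⁅Xop k I i, x⁆⁆ = 0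
    rcases hx with ⟨j, rfl⟩ | ⟨j, rfl⟩
    · rw [lie_Xop_Xop, lie_zero]
    · rw [lie_Xop_Yop, Ring.lie_def, Algebra.commutes, sub_self]
  | algebraMap r =>
    rw [LieSubalgebra.mem_engel_iff]
    refine ⟨1, ?_⟩
    rw [pow_one, LieAlgebra.ad_apply]
    change ⁅XA k I i, algebraMap k (Weyl k I) r⁆ = 0
    rw [Ring.lie_def, Algebra.commutes, sub_self]
  | add x y hx hy ihx ihy => exact add_mem ihx ihy
  | mul x y hx hy ihx ihy =>
    rw [LieSubalgebra.mem_engel_iff] at *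
    obtain ⟨n, hn⟩ := ihx
    obtain ⟨m, hm⟩ := ihy
    exact ⟨n + m, ad_pow_add_mul_eq_zero _ n m _ _ hn hm⟩

end LocallyNilpotent

/-- The adjoint action of each `X i` on the Weyl algebra is locally
nilpotent, and consequently, for any `J ⊆ I`, the multiplicative monoid generated by the
`X i`, `i ∈ J`, is a left and a right Ore set in the Weyl algebra. -/
theorem ad_X_locally_nilpotent_and_ore [IsAlgClosed k] [CharZero k] [Infinite I] :
    (∀ (i : I) (a : Weyl k I), ∃ n : ℕ,
      (fun b => XA k I i * b - b * XA k I i)^[n] a = 0) ∧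
    (∀ J : Set I, ∀ a : Weyl k I, ∀ s ∈ Submonoid.closure (XA k I '' J),
      (∃ b : Weyl k I, ∃ t ∈ Submonoid.closure (XA k I '' J), t * a = b * s) ∧
      (∃ b' : Weyl k I, ∃ t' ∈ Submonoid.closure (XA k I '' J), a * t' = s * b')) := by
  refine ⟨fun i a => ?_, fun J a s hs => ⟨?_, ?_⟩⟩
  · obtain ⟨n, hn⟩ := exists_ad_XA_pow_eq_zero k I i a
    rw [Module.End.pow_apply] at hn
    exact ⟨n, hn⟩
  · refine left_ore_closure ?_ hs a
    rintro _ ⟨i, hi, rfl⟩ a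
    obtain ⟨n, hn⟩ := exists_ad_XA_pow_eq_zero k I i a
    obtain ⟨b, hb⟩ := exists_pow_mul_eq_mul_of_ad_pow_eq_zero _ n a hn
    exact ⟨b, _, pow_mem (Submonoid.subset_closure (Set.mem_image_of_mem _ hi)) n, hb⟩
  · refine right_ore_closure ?_ hs a
    rintro _ ⟨i, hi, rfl⟩ a
    obtain ⟨n, hn⟩ := exists_ad_XA_pow_eq_zero k I i a
    obtain ⟨b, hb⟩ := exists_mul_pow_eq_mul_of_ad_pow_eq_zero _ n a hn
    exact ⟨b, _, pow_mem (Submonoid.subset_closure (Set.mem_image_of_mem _ hi)) n, hb⟩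
end
end
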